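/- Let k ≥ 1 and 1/3 < a < 2/3 with a ≠ 1/2. For x ∈ (0,1) set r_n(x) := l_n(x) − n·φ(a). Then M_{k,a} has a finite derivative at x if and only if r_n(x) − k·C₀(a)·log n → +∞ as n → ∞, and in that case M_{k,a}'(x) = 0. -/

import Mathlib

open Filter Topology MeasureTheory Set
open scoped ENNReal

/-- The `(n+1)`-th ternary digit of `x` (choosing the expansion ending in all `0`s
when two expansions exist, and the all-`2`s expansion for `x = 1`). -/
noncomputable def tDigit (x : ℝ) (n : ℕ) : ℕ :=
  if x = 1 then 2 else (⌊(3:ℝ) ^ (n + 1) * x⌋ - 3 * ⌊(3:ℝ) ^ n * x⌋).toNat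

/-- `l_n(x)`: the number of `1`s among the first `n` ternary digits of `x`. -/
noncomputable def lCount (x : ℝ) (n : ℕ) : ℕ :=
  ((Finset.range n).filter (fun i => tDigit x i = 1)).card

/-- `q_a(d)` with `q_a(0)=0`, `q_a(1)=a`, `q_a(2)=1-a`. -/
noncomputable def qDig (a : ℝ) (d : ℕ) : ℝ :=
  if d = 0 then 0 else if d = 1 then a else 1 - a

/-- Okamoto's function `F_a`. -/
noncomputable def Okamoto (a x : ℝ) : ℝ :=
  ∑' n : ℕ, a ^ (n - lCount x n) * (1 - 2 * a) ^ lCount x n * qDig a (tDigit x n)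

/-- `M_{k,a}(x)`: the `k`-th partial derivative of `F_a(x)` with respect to `a`. -/
noncomputable def Mfun (k : ℕ) (a x : ℝ) : ℝ :=
  iteratedDeriv k (fun b => Okamoto b x) a

/-- `f` has derivative `+∞` at `x` (difference quotients over `y ∈ [0,1] \ {x}`). -/
def derivPInf (f : ℝ → ℝ) (x : ℝ) : Prop :=
  Tendsto (fun y => (f y - f x) / (y - x)) (𝓝[Set.Icc 0 1 \ {x}] x) atTop

/-- `f` has derivative `-∞` at `x`. -/
def derivMInf (f : ℝ → ℝ) (x : ℝ) : Prop :=
  Tendsto (fun y => (f y - f x) / (y - x)) (𝓝[Set.Icc 0 1 \ {x}] x) atBot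

noncomputable def phiOk (a : ℝ) : ℝ :=
  if a = 1/3 then 1/3 else if a = 1/2 then 0
  else Real.log (3 * a) / (Real.log a - Real.log |1 - 2 * a|)

noncomputable def C0 (a : ℝ) : ℝ := 1 / (Real.log a - Real.log |1 - 2 * a|)

noncomputable def hEnt (p : ℝ) : ℝ :=
  (-(p * Real.log p) - (1 - p) * Real.log (1 - p) + (1 - p) * Real.log 2) / Real.log 3

noncomputable def dOk (a : ℝ) : ℝ := hEnt (phiOk a)

noncomputable def dTilde (a : ℝ) : ℝ := hEnt (1 - 2 * a)

/-- The `j`-th derivative of `b ↦ b ^ m * (1 - 2 * b) ^ l`. -/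
noncomputable def wDeriv : ℕ → ℕ → ℕ → ℝ → ℝ
  | 0, m, l, b => b ^ m * (1 - 2 * b) ^ l
  | j + 1, m, l, b => m * wDeriv j (m - 1) l b - 2 * l * wDeriv j m (l - 1) b

lemma hasDerivAt_wDeriv (j m l : ℕ) (b : ℝ) :
    HasDerivAt (wDeriv j m l) (wDeriv (j + 1) m l b) b := by
  induction j generalizing m l with
  | zero =>
    have h1 : HasDerivAt (fun b : ℝ => b ^ m) (m * b ^ (m - 1)) b := hasDerivAt_pow m b
    have h2 : HasDerivAt (fun b : ℝ => (1 - 2 * b)) (-2) b := by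
      simpa using ((hasDerivAt_id b).const_mul 2).const_sub 1
    have h := h1.mul (h2.pow l)
    refine (h.congr_deriv ?_)
    simp only [wDeriv, Pi.pow_apply]
    ring
  | succ j ih =>
    exact ((ih (m - 1) l).const_mul (m : ℝ)).sub ((ih m (l - 1)).const_mul (2 * l : ℝ))

lemma wDeriv_succ_right (j m l : ℕ) (b : ℝ) :
    wDeriv j m (l + 1) b = wDeriv j m l b - 2 * wDeriv j (m + 1) l b := by
  induction j generalizing b with
  | zero => simp only [wDeriv]; ring
  | succ j ih =>
    have h := (hasDerivAt_wDeriv j m l b).sub ((hasDerivAt_wDeriv j (m + 1) l b).const_mul 2)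
    refine (hasDerivAt_wDeriv j m (l + 1) b).unique (h.congr_of_eventuallyEq ?_)
    exact Eventually.of_forall ih

lemma wDeriv_succ_left (j m l : ℕ) (b : ℝ) :
    wDeriv (j + 1) (m + 1) l b = b * wDeriv (j + 1) m l b + (j + 1) * wDeriv j m l b := by
  induction j generalizing b with
  | zero =>
    have h : HasDerivAt (fun b => b * wDeriv 0 m l b) _ b :=
      (hasDerivAt_id b).mul (hasDerivAt_wDeriv 0 m l b)
    have h' := (hasDerivAt_wDeriv 0 (m + 1) l b).unique (h.congr_of_eventuallyEq
      (Eventually.of_forall fun b => by simp only [wDeriv]; ring))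
    rw [h']
    simp only [id_eq]
    push_cast
    ring
  | succ j ih =>
    have h : HasDerivAt (fun b => b * wDeriv (j + 1) m l b + (j + 1) * wDeriv j m l b) _ b :=
      ((hasDerivAt_id b).mul (hasDerivAt_wDeriv (j + 1) m l b)).add
        ((hasDerivAt_wDeriv j m l b).const_mul (j + 1 : ℝ))
    have h' := (hasDerivAt_wDeriv (j + 1) (m + 1) l b).unique (h.congr_of_eventuallyEq
      (Eventually.of_forall ih))
    rw [h']
    simp only [id_eq]
    push_cast
    ring

lemma abs_wDeriv_le (j m l : ℕ) {b : ℝ} (hb : b ≠ 0) (hc : 1 - 2 * b ≠ 0) :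
    |wDeriv j m l b| ≤
      (1 / |b| + 2 / |1 - 2 * b|) ^ j * ((m : ℝ) + l + 1) ^ j * (|b| ^ m * |1 - 2 * b| ^ l) := by
  have hb' : 0 < |b| := abs_pos.2 hb
  have hc' : 0 < |1 - 2 * b| := abs_pos.2 hc
  set B := |b|
  set c := |1 - 2 * b|
  have hBeq : |b| = B := rfl
  have hceq : |1 - 2 * b| = c := rfl
  set K := 1 / B + 2 / c
  have hK : 0 < K := by positivity
  induction j generalizing m l with
  | zero => simp [wDeriv, abs_mul, abs_pow, hBeq, hceq]
  | succ j ih =>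
    have e1 : |(m : ℝ) * wDeriv j (m - 1) l b| ≤
        1 / B * (K ^ j * ((m : ℝ) + l + 1) ^ (j + 1) * (B ^ m * c ^ l)) := by
      rcases m with _ | m
      · simp; positivity
      · rw [abs_mul, Nat.abs_cast, Nat.add_sub_cancel]
        calc ((m + 1 : ℕ) : ℝ) * |wDeriv j m l b|
            ≤ (((m + 1 : ℕ) : ℝ) + l + 1) *
              (K ^ j * (((m + 1 : ℕ) : ℝ) + l + 1) ^ j * (B ^ m * c ^ l)) := by
              have hm : (m : ℝ) ≤ (m + 1 : ℕ) := by push_cast; linarith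
              have hl : (0 : ℝ) ≤ l := l.cast_nonneg
              gcongr
              · linarith
              · refine (ih m l).trans ?_
                gcongr
          _ = _ := by field_simp; ring
    have e2 : |2 * (l : ℝ) * wDeriv j m (l - 1) b| ≤
        2 / c * (K ^ j * ((m : ℝ) + l + 1) ^ (j + 1) * (B ^ m * c ^ l)) := by
      rcases l with _ | l
      · simp; positivity
      · rw [abs_mul, abs_mul, Nat.abs_cast, Nat.add_sub_cancel, abs_two]
        calc 2 * ((l + 1 : ℕ) : ℝ) * |wDeriv j m l b|
            ≤ 2 * ((m : ℝ) + (l + 1 : ℕ) + 1) *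
              (K ^ j * ((m : ℝ) + (l + 1 : ℕ) + 1) ^ j * (B ^ m * c ^ l)) := by
              have hm : (l : ℝ) ≤ (l + 1 : ℕ) := by push_cast; linarith
              have hl : (0 : ℝ) ≤ m := m.cast_nonneg
              gcongr
              · linarith
              · refine (ih m l).trans ?_
                gcongr
          _ = _ := by field_simp; ring
    calc |wDeriv (j + 1) m l b| ≤ _ := abs_sub _ _
      _ ≤ _ := add_le_add e1 e2
      _ = _ := by rw [← add_mul, pow_succ K]; ring

/-- To leading order, the `j`-th derivative of `b ^ m * (1 - 2 * b) ^ l` is the function times the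
`j`-th power of its logarithmic derivative. -/
lemma exists_abs_wDeriv_sub_le (j : ℕ) {b : ℝ} (hb : b ≠ 0) (hc : 1 - 2 * b ≠ 0) :
    ∃ C : ℝ, 0 ≤ C ∧ ∀ m l : ℕ,
      |wDeriv (j + 1) m l b - wDeriv 0 m l b * (m / b - 2 * l / (1 - 2 * b)) ^ (j + 1)| ≤
        C * ((m : ℝ) + l + 1) ^ j * |wDeriv 0 m l b| := by
  induction j with
  | zero =>
    refine ⟨0, le_rfl, fun m l => ?_⟩
    have : wDeriv 1 m l b = wDeriv 0 m l b * (m / b - 2 * l / (1 - 2 * b)) := by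
      rcases m with _ | m <;> rcases l with _ | l <;> simp [wDeriv] <;> field_simp <;> ring
    simp [this]
  | succ j ih =>
    obtain ⟨C, hC, ih⟩ := ih
    set c := 1 - 2 * b with hcdef
    set K := 1 / |b| + 2 / |c| with hK
    have hb' : 0 < |b| := abs_pos.2 hb
    have hc' : 0 < |c| := abs_pos.2 hc
    have hK0 : 0 < K := by positivity
    have hlog : ∀ m l : ℕ, |(m : ℝ) / b - 2 * l / c| ≤ K * ((m : ℝ) + l + 1) := by
      intro m l
      have hm : (0 : ℝ) ≤ m := m.cast_nonneg
      have hl : (0 : ℝ) ≤ l := l.cast_nonneg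
      refine (abs_sub _ _).trans ?_
      rw [abs_div, abs_div, abs_mul, Nat.abs_cast, Nat.abs_cast, abs_two]
      have h1 : (m : ℝ) / |b| ≤ 1 / |b| * ((m : ℝ) + l + 1) := by
        rw [div_eq_mul_one_div, mul_comm]; gcongr; linarith
      have h2 : 2 * (l : ℝ) / |c| ≤ 2 / |c| * ((m : ℝ) + l + 1) := by
        rw [mul_div_right_comm]; gcongr; linarith
      rw [hK, add_mul]; linarith
    set D := C + K * (j + 1) * K ^ j with hD
    have hD0 : 0 ≤ D := by positivity
    -- comparison of a lowered term with the leading one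
    have key : ∀ (m l m' l' : ℕ), m' ≤ m → l' ≤ l →
        |((m' : ℝ) / b - 2 * l' / c) - (m / b - 2 * l / c)| ≤ K →
        |wDeriv (j + 1) m' l' b - wDeriv 0 m' l' b * (m / b - 2 * l / c) ^ (j + 1)| ≤
          D * ((m : ℝ) + l + 1) ^ j * |wDeriv 0 m' l' b| := by
      intro m l m' l' hm hl hd
      have hm' : (m' : ℝ) ≤ m := by exact_mod_cast hm
      have hl' : (l' : ℝ) ≤ l := by exact_mod_cast hl
      have h1 := ih m' l'
      have h2 := abs_pow_sub_pow_le ((m' : ℝ) / b - 2 * l' / c) (m / b - 2 * l / c) (j + 1)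
      have h3 : max |(m' : ℝ) / b - 2 * l' / c| |(m : ℝ) / b - 2 * l / c| ≤
          K * ((m : ℝ) + l + 1) := by
        refine max_le ((hlog m' l').trans ?_) (hlog m l)
        gcongr
      have h4 : |((m' : ℝ) / b - 2 * l' / c) ^ (j + 1) - (m / b - 2 * l / c) ^ (j + 1)| ≤
          K * (j + 1) * (K * ((m : ℝ) + l + 1)) ^ j := by
        refine h2.trans ?_
        push_cast
        gcongr
      calc _ ≤ |wDeriv (j + 1) m' l' b - wDeriv 0 m' l' b * (m' / b - 2 * l' / c) ^ (j + 1)| +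
            |wDeriv 0 m' l' b| *
              |((m' : ℝ) / b - 2 * l' / c) ^ (j + 1) - (m / b - 2 * l / c) ^ (j + 1)| := by
            rw [← abs_mul]
            refine le_trans (le_of_eq ?_) (abs_add_le _ _)
            congr 1; ring
        _ ≤ C * ((m : ℝ) + l + 1) ^ j * |wDeriv 0 m' l' b| +
            |wDeriv 0 m' l' b| * (K * (j + 1) * (K * ((m : ℝ) + l + 1)) ^ j) := by
            gcongr
            refine h1.trans ?_
            gcongr
        _ = _ := by rw [hD, mul_pow]; ring
    refine ⟨D * K, by positivity, fun m l => ?_⟩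
    set h := (m : ℝ) / b - 2 * l / c with hh
    set G := wDeriv 0 m l b with hG
    have e1 : |(m : ℝ) * wDeriv (j + 1) (m - 1) l b - G * (m / b) * h ^ (j + 1)| ≤
        1 / |b| * (D * ((m : ℝ) + l + 1) ^ (j + 1) * |G|) := by
      rcases m with _ | m
      · simp; positivity
      · have hG' : G = b * wDeriv 0 m l b := by rw [hG]; simp only [wDeriv]; ring
        have hk := key (m + 1) l m l (Nat.le_succ m) le_rfl (by
          have : ((m : ℝ) / b - 2 * l / c) - ((m + 1 : ℕ) / b - 2 * l / c) = -(1 / b) := by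
            push_cast; ring
          rw [this, abs_neg, abs_div, abs_one, hK]
          have : 0 < 2 / |c| := by positivity
          linarith)
        rw [Nat.add_sub_cancel, hG', abs_mul]
        have : ((m + 1 : ℕ) : ℝ) * wDeriv (j + 1) m l b -
            b * wDeriv 0 m l b * ((m + 1 : ℕ) / b) * h ^ (j + 1) = ((m + 1 : ℕ) : ℝ) *
            (wDeriv (j + 1) m l b - wDeriv 0 m l b * h ^ (j + 1)) := by
          field_simp
        rw [this, abs_mul, Nat.abs_cast]
        have hl : (0 : ℝ) ≤ l := l.cast_nonneg
        calc _ ≤ (((m + 1 : ℕ) : ℝ) + l + 1) *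
              (D * (((m + 1 : ℕ) : ℝ) + l + 1) ^ j * |wDeriv 0 m l b|) := by
              gcongr
              linarith
          _ = _ := by field_simp; ring
    have e2 : |2 * (l : ℝ) * wDeriv (j + 1) m (l - 1) b - G * (2 * l / c) * h ^ (j + 1)| ≤
        2 / |c| * (D * ((m : ℝ) + l + 1) ^ (j + 1) * |G|) := by
      rcases l with _ | l
      · simp; positivity
      · have hG' : G = c * wDeriv 0 m l b := by rw [hG]; simp only [wDeriv]; ring
        have hk := key m (l + 1) m l le_rfl (Nat.le_succ l) (by
          have : ((m : ℝ) / b - 2 * l / c) - (m / b - 2 * (l + 1 : ℕ) / c) = 2 / c := by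
            push_cast; ring
          rw [this, abs_div, abs_two, hK]
          have : 0 < 1 / |b| := by positivity
          linarith)
        rw [Nat.add_sub_cancel, hG', abs_mul]
        have : 2 * ((l + 1 : ℕ) : ℝ) * wDeriv (j + 1) m l b -
            c * wDeriv 0 m l b * (2 * (l + 1 : ℕ) / c) * h ^ (j + 1) = 2 * ((l + 1 : ℕ) : ℝ) *
            (wDeriv (j + 1) m l b - wDeriv 0 m l b * h ^ (j + 1)) := by
          field_simp
        rw [this, abs_mul, abs_mul, Nat.abs_cast, abs_two]
        have hl : (0 : ℝ) ≤ m := m.cast_nonneg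
        calc _ ≤ 2 * ((m : ℝ) + (l + 1 : ℕ) + 1) *
              (D * ((m : ℝ) + (l + 1 : ℕ) + 1) ^ j * |wDeriv 0 m l b|) := by
              gcongr
              linarith
          _ = _ := by field_simp; ring
    calc _ = |((m : ℝ) * wDeriv (j + 1) (m - 1) l b - G * (m / b) * h ^ (j + 1)) -
          (2 * (l : ℝ) * wDeriv (j + 1) m (l - 1) b - G * (2 * l / c) * h ^ (j + 1))| := by
          rw [wDeriv]; congr 1; rw [pow_succ h (j + 1)]; nth_rewrite 2 [hh]; ring
      _ ≤ _ := abs_sub _ _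
      _ ≤ _ := add_le_add e1 e2
      _ = _ := by rw [hK]; ring

/-- The `k`-th derivative of `b ↦ b ^ m * (1 - 2 * b) ^ l * qDig b d`. -/
noncomputable def qDeriv (k m l d : ℕ) (b : ℝ) : ℝ :=
  if d = 0 then 0 else if d = 1 then wDeriv k (m + 1) l b
  else wDeriv k m l b - wDeriv k (m + 1) l b

/-- The `k`-th derivative in `b` of the `n`-th term of the series `Okamoto b y`. -/
noncomputable def termDeriv (k : ℕ) (y : ℝ) (n : ℕ) (b : ℝ) : ℝ :=
  qDeriv k (n - lCount y n) (lCount y n) (tDigit y n) b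

lemma lCount_le (y : ℝ) (n : ℕ) : lCount y n ≤ n :=
  (Finset.card_filter_le _ _).trans_eq (Finset.card_range n)

lemma lCount_succ (y : ℝ) (n : ℕ) :
    lCount y (n + 1) = lCount y n + if tDigit y n = 1 then 1 else 0 := by
  unfold lCount
  rw [Finset.range_add_one, Finset.filter_insert]
  split_ifs <;> simp

lemma hasDerivAt_qDeriv (k m l d : ℕ) (b : ℝ) :
    HasDerivAt (qDeriv k m l d) (qDeriv (k + 1) m l d b) b := by
  unfold qDeriv
  split_ifs
  · exact hasDerivAt_const b 0
  · exact hasDerivAt_wDeriv k (m + 1) l b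
  · exact (hasDerivAt_wDeriv k m l b).sub (hasDerivAt_wDeriv k (m + 1) l b)

lemma abs_qDeriv_le (k m l d : ℕ) {b : ℝ} (hb : b ≠ 0) (hc : 1 - 2 * b ≠ 0) (hb1 : |b| ≤ 1) :
    |qDeriv k m l d b| ≤ (1 / |b| + 2 / |1 - 2 * b|) ^ k * (1 + 2 ^ k) *
      ((m : ℝ) + l + 1) ^ k * (|b| ^ m * |1 - 2 * b| ^ l) := by
  set K := 1 / |b| + 2 / |1 - 2 * b|
  have hK : 0 ≤ K := by positivity
  have h1 : |wDeriv k m l b| ≤ K ^ k * ((m : ℝ) + l + 1) ^ k * (|b| ^ m * |1 - 2 * b| ^ l) :=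
    abs_wDeriv_le k m l hb hc
  have h2 : |wDeriv k (m + 1) l b| ≤
      K ^ k * 2 ^ k * ((m : ℝ) + l + 1) ^ k * (|b| ^ m * |1 - 2 * b| ^ l) := by
    refine (abs_wDeriv_le k (m + 1) l hb hc).trans ?_
    have hm : (0 : ℝ) ≤ m := m.cast_nonneg
    have hl : (0 : ℝ) ≤ l := l.cast_nonneg
    rw [mul_assoc (K ^ k) (2 ^ k), ← mul_pow 2]
    gcongr ?_ ^ k * ?_ ^ k * (?_ * _)
    · push_cast; linarith
    · rw [pow_succ]; exact mul_le_of_le_one_right (by positivity) hb1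
  have hE : K ^ k * (1 + 2 ^ k) * ((m : ℝ) + l + 1) ^ k * (|b| ^ m * |1 - 2 * b| ^ l) =
      K ^ k * ((m : ℝ) + l + 1) ^ k * (|b| ^ m * |1 - 2 * b| ^ l) +
      K ^ k * 2 ^ k * ((m : ℝ) + l + 1) ^ k * (|b| ^ m * |1 - 2 * b| ^ l) := by ring
  rw [hE]
  unfold qDeriv
  split_ifs
  · rw [abs_zero]; positivity
  · exact h2.trans (le_add_of_nonneg_left (by positivity))
  · exact (abs_sub _ _).trans (add_le_add h1 h2)

lemma okamoto_eq_tsum (b y : ℝ) : Okamoto b y = ∑' n, termDeriv 0 y n b := by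
  unfold Okamoto termDeriv qDeriv qDig
  refine tsum_congr fun n => ?_
  simp only [wDeriv]
  split_ifs <;> ring

lemma abs_termDeriv_le (k : ℕ) (y : ℝ) (n : ℕ) {b : ℝ} (hb : b ≠ 0) (hc : 1 - 2 * b ≠ 0)
    (hb1 : |b| ≤ 1) :
    |termDeriv k y n b| ≤ (1 / |b| + 2 / |1 - 2 * b|) ^ k * (1 + 2 ^ k) *
      ((n : ℝ) + 1) ^ k * (|b| ^ (n - lCount y n) * |1 - 2 * b| ^ lCount y n) := by
  have h := abs_qDeriv_le k (n - lCount y n) (lCount y n) (tDigit y n) hb hc hb1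
  rwa [Nat.cast_sub (lCount_le y n), sub_add_cancel] at h

/-- The `k`-th derivative of Okamoto's function in the parameter is the termwise derivative. -/
lemma mfun_eq_tsum (k : ℕ) {a : ℝ} (h0 : 0 < a) (h1 : a < 1) (h2 : a ≠ 1 / 2) (y : ℝ) :
    Summable (fun n => termDeriv k y n a) ∧ Mfun k a y = ∑' n, termDeriv k y n a := by
  have hc : 1 - 2 * a ≠ 0 := fun h => h2 (by linarith)
  have hmax : max |a| |1 - 2 * a| < 1 := by
    refine max_lt ?_ ?_ <;> rw [abs_lt] <;> constructor <;> linarith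
  obtain ⟨ρ, hρ, hρ1⟩ := exists_between hmax
  have hρ0 : 0 < ρ := (abs_nonneg a).trans_lt ((le_max_left _ _).trans_lt hρ)
  set K := 1 / |a| + 2 / |1 - 2 * a| + 1 with hK
  have hK0 : 0 < K := by positivity
  have ev : ∀ᶠ b in 𝓝 a, b ≠ 0 ∧ 1 - 2 * b ≠ 0 ∧ |b| < ρ ∧ |1 - 2 * b| < ρ ∧
      1 / |b| + 2 / |1 - 2 * b| < K := by
    have c1 : ContinuousAt (fun b : ℝ => 1 - 2 * b) a := by fun_prop
    have c2 : ContinuousAt (fun b : ℝ => 1 / |b| + 2 / |1 - 2 * b|) a := by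
      have := abs_pos.2 h0.ne'
      have := abs_pos.2 hc
      fun_prop (disch := positivity)
    exact ((continuousAt_id.eventually_ne h0.ne').and ((c1.eventually_ne hc).and
      ((continuousAt_id.abs.eventually_lt_const ((le_max_left _ _).trans_lt hρ)).and
      ((c1.abs.eventually_lt_const ((le_max_right _ _).trans_lt hρ)).and
      (c2.eventually_lt_const (by rw [hK]; linarith))))))
  obtain ⟨r, hr, hball⟩ := Metric.eventually_nhds_iff_ball.1 ev
  have hsum : ∀ k : ℕ, Summable fun n : ℕ =>
      K ^ k * (1 + 2 ^ k) * (((n : ℝ) + 1) ^ k * ρ ^ n) := by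
    intro k
    refine Summable.mul_left _ ?_
    have h := (summable_nat_add_iff 1).2 (summable_pow_mul_geometric_of_norm_lt_one k
      (r := ρ) (by rwa [Real.norm_of_nonneg hρ0.le]))
    refine (h.mul_left ρ⁻¹).congr fun n => ?_
    rw [pow_succ ρ n]
    push_cast
    field_simp
  have hbd : ∀ k n, ∀ b ∈ Metric.ball a r, ‖termDeriv k y n b‖ ≤
      K ^ k * (1 + 2 ^ k) * (((n : ℝ) + 1) ^ k * ρ ^ n) := by
    intro k n b hb
    obtain ⟨b0, bc, bρ, cρ, bK⟩ := hball b hb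
    refine (abs_termDeriv_le k y n b0 bc (bρ.trans hρ1).le).trans ?_
    rw [← mul_assoc (K ^ k * _)]
    have hsplit : ρ ^ n = ρ ^ (n - lCount y n) * ρ ^ lCount y n := by
      rw [← pow_add, Nat.sub_add_cancel (lCount_le y n)]
    rw [hsplit]
    exact mul_le_mul (mul_le_mul_of_nonneg_right (mul_le_mul_of_nonneg_right
      (pow_le_pow_left₀ (by positivity) bK.le k) (by positivity)) (by positivity))
      (mul_le_mul (pow_le_pow_left₀ (abs_nonneg _) bρ.le _) (pow_le_pow_left₀ (abs_nonneg _) cρ.le _)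
      (by positivity) (by positivity)) (by positivity) (by positivity)
  have hs : ∀ k, ∀ b ∈ Metric.ball a r, Summable fun n => termDeriv k y n b := fun k b hb =>
    Summable.of_norm_bounded (hsum k) fun n => hbd k n b hb
  have main : ∀ k, ∀ b ∈ Metric.ball a r,
      iteratedDeriv k (fun b => Okamoto b y) b = ∑' n, termDeriv k y n b := by
    intro k
    induction k with
    | zero => intro b _; simp [okamoto_eq_tsum]
    | succ k ih =>
      intro b hb
      have hd : HasDerivAt (fun b => ∑' n, termDeriv k y n b) (∑' n, termDeriv (k + 1) y n b) b :=
        hasDerivAt_tsum_of_isPreconnected (hsum (k + 1)) Metric.isOpen_ball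
          (convex_ball a r).isPreconnected (fun n b _ => hasDerivAt_qDeriv _ _ _ _ b)
          (hbd (k + 1)) hb (hs k b hb) hb
      rw [iteratedDeriv_succ, ← hd.deriv]
      refine EventuallyEq.deriv_eq ?_
      filter_upwards [Metric.isOpen_ball.mem_nhds hb] with z hz using ih z hz
  exact ⟨hs k a (Metric.mem_ball_self hr), main k a (Metric.mem_ball_self hr)⟩

/-- The number of digits `1` among the last `n` ternary digits of `N`. -/
def ternaryOnes : ℕ → ℕ → ℕ
  | 0, _ => 0
  | n + 1, N => ternaryOnes n (N / 3) + if N % 3 = 1 then 1 else 0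

lemma ternaryOnes_le (n N : ℕ) : ternaryOnes n N ≤ n := by
  induction n generalizing N with
  | zero => rfl
  | succ n ih =>
    have := ih (N / 3)
    unfold ternaryOnes
    split_ifs <;> omega

lemma floor_three_pow_div (y : ℝ) (n : ℕ) :
    ⌊(3 : ℝ) ^ (n + 1) * y⌋₊ / 3 = ⌊(3 : ℝ) ^ n * y⌋₊ := by
  rw [← Nat.floor_div_natCast]
  congr 1
  push_cast
  ring

lemma tDigit_eq {y : ℝ} (h0 : 0 ≤ y) (h1 : y < 1) (n : ℕ) :
    tDigit y n = ⌊(3 : ℝ) ^ (n + 1) * y⌋₊ % 3 := by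
  have h := floor_three_pow_div y n
  unfold tDigit
  rw [if_neg h1.ne, ← Int.natCast_floor_eq_floor (by positivity),
    ← Int.natCast_floor_eq_floor (by positivity)]
  omega

lemma lCount_eq {y : ℝ} (h0 : 0 ≤ y) (h1 : y < 1) (n : ℕ) :
    lCount y n = ternaryOnes n ⌊(3 : ℝ) ^ n * y⌋₊ := by
  induction n with
  | zero => simp [lCount, ternaryOnes]
  | succ n ih => rw [lCount_succ, ih, tDigit_eq h0 h1, ternaryOnes, floor_three_pow_div]

/-- The `k`-th derivative in the parameter of the first `n` terms of Okamoto's series at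
`N / 3 ^ n`. -/
noncomputable def partialDeriv (k : ℕ) (b : ℝ) : ℕ → ℕ → ℝ
  | 0, _ => 0
  | n + 1, N => partialDeriv k b n (N / 3) +
      qDeriv k (n - ternaryOnes n (N / 3)) (ternaryOnes n (N / 3)) (N % 3) b

lemma sum_termDeriv_eq (k : ℕ) (b : ℝ) {y : ℝ} (h0 : 0 ≤ y) (h1 : y < 1) (n : ℕ) :
    ∑ i ∈ Finset.range n, termDeriv k y i b = partialDeriv k b n ⌊(3 : ℝ) ^ n * y⌋₊ := by
  induction n with
  | zero => simp [partialDeriv]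
  | succ n ih =>
    rw [Finset.sum_range_succ, ih, partialDeriv, floor_three_pow_div, termDeriv,
      lCount_eq h0 h1, tDigit_eq h0 h1]

lemma ternaryOnes_succ_le (n N : ℕ) :
    ternaryOnes n (N + 1) ≤ ternaryOnes n N + 1 ∧ ternaryOnes n N ≤ ternaryOnes n (N + 1) + 1 := by
  induction n generalizing N with
  | zero => simp [ternaryOnes]
  | succ n ih =>
    unfold ternaryOnes
    rcases (by omega : N % 3 = 0 ∨ N % 3 = 1 ∨ N % 3 = 2) with h | h | h
    · rw [show (N + 1) / 3 = N / 3 by omega, show (N + 1) % 3 = 1 by omega, h]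
      constructor <;> (simp; try omega)
    · rw [show (N + 1) / 3 = N / 3 by omega, show (N + 1) % 3 = 2 by omega, h]
      constructor <;> (simp; try omega)
    · rw [show (N + 1) / 3 = N / 3 + 1 by omega, show (N + 1) % 3 = 0 by omega, h]
      simpa using ih (N / 3)

/-- The increment over a triadic interval. -/
lemma partialDeriv_succ_sub (k : ℕ) (b : ℝ) (n N : ℕ) (hN : N + 1 < 3 ^ n) :
    partialDeriv k b n (N + 1) - partialDeriv k b n N =
      wDeriv k (n - ternaryOnes n N) (ternaryOnes n N) b := by
  induction n generalizing N with
  | zero => simp at hN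
  | succ n ih =>
    have hle := ternaryOnes_le n (N / 3)
    rcases (by omega : N % 3 = 0 ∨ N % 3 = 1 ∨ N % 3 = 2) with h | h | h
    · simp only [partialDeriv, ternaryOnes, show (N + 1) / 3 = N / 3 by omega,
        show (N + 1) % 3 = 1 by omega, h, qDeriv]
      norm_num
      congr 1; omega
    · simp only [partialDeriv, ternaryOnes, show (N + 1) / 3 = N / 3 by omega,
        show (N + 1) % 3 = 2 by omega, h, qDeriv]
      norm_num
      rw [wDeriv_succ_right, show n + 1 - (ternaryOnes n (N / 3) + 1) =
        n - ternaryOnes n (N / 3) by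
        omega]
      ring
    · have := ih (N / 3) (by rw [pow_succ] at hN; omega)
      simp only [partialDeriv, ternaryOnes, show (N + 1) / 3 = N / 3 + 1 by omega,
        show (N + 1) % 3 = 0 by omega, h, qDeriv]
      norm_num
      rw [show n + 1 - ternaryOnes n (N / 3) = n - ternaryOnes n (N / 3) + 1 by omega]
      linear_combination this

lemma mfun_triadic (k : ℕ) {a : ℝ} (h0 : 0 < a) (h1 : a < 1) (h2 : a ≠ 1 / 2) (n N : ℕ)
    (hN : N < 3 ^ n) : Mfun k a (N / 3 ^ n) = partialDeriv k a n N := by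
  have hy0 : (0 : ℝ) ≤ N / 3 ^ n := by positivity
  have hy1 : (N : ℝ) / 3 ^ n < 1 := by
    rw [div_lt_one (by positivity)]; exact_mod_cast hN
  rw [(mfun_eq_tsum k h0 h1 h2 _).2, tsum_eq_sum (s := Finset.range n),
    sum_termDeriv_eq k a hy0 hy1]
  · rw [mul_div_cancel₀ _ (by positivity), Nat.floor_natCast]
  · intro i hi
    obtain ⟨j, rfl⟩ := Nat.exists_eq_add_of_le (not_lt.1 (Finset.mem_range.not.1 hi))
    have : (3 : ℝ) ^ (n + j + 1) * (N / 3 ^ n) = ((3 ^ j * N * 3 : ℕ) : ℝ) := by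
      push_cast; field_simp; ring
    rw [termDeriv, tDigit_eq hy0 hy1, this, Nat.floor_natCast, Nat.mul_mod_left]
    simp [qDeriv]

/-- The absolute value of the increment of Okamoto's function over the triadic interval
`[N / 3 ^ n, (N + 1) / 3 ^ n]`. -/
noncomputable def triadicWeight (a : ℝ) (n N : ℕ) : ℝ :=
  a ^ (n - ternaryOnes n N) * |1 - 2 * a| ^ ternaryOnes n N

lemma pow_mul_pow_le_of_close {a c : ℝ} (hc : 0 < c) (hca : c ≤ a) {n l l' : ℕ} (hl : l ≤ n)
    (hl' : l' ≤ n) (h1 : l' ≤ l + 1) (h2 : l ≤ l' + 1) :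
    a ^ (n - l') * c ^ l' ≤ a / c * (a ^ (n - l) * c ^ l) := by
  have ha : 0 < a := hc.trans_le hca
  rw [div_mul_eq_mul_div, le_div_iff₀ hc]
  rcases (by omega : l' = l ∨ l' = l + 1 ∨ l = l' + 1) with rfl | rfl | rfl
  · rw [mul_comm]; gcongr
  · obtain ⟨m, hm⟩ := Nat.exists_eq_add_of_le hl'
    rw [show n - (l + 1) = m by omega, show n - l = m + 1 by omega]
    have : c ^ 2 ≤ a ^ 2 := by gcongr
    calc a ^ m * c ^ (l + 1) * c = a ^ m * c ^ l * c ^ 2 := by ring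
      _ ≤ a ^ m * c ^ l * a ^ 2 := by gcongr
      _ = _ := by ring
  · obtain ⟨m, hm⟩ := Nat.exists_eq_add_of_le hl
    rw [show n - l' = m + 1 by omega, show n - (l' + 1) = m by omega]
    exact le_of_eq (by ring)

lemma exists_abs_mfun_sub_partialDeriv_le (k : ℕ) {a : ℝ} (h0 : 0 < a) (h1 : a < 1)
    (h2 : a ≠ 1 / 2) (hca : |1 - 2 * a| ≤ a) :
    ∃ C : ℝ, 0 ≤ C ∧ ∀ y : ℝ, 0 ≤ y → y < 1 → ∀ n : ℕ,
      |Mfun k a y - partialDeriv k a n ⌊(3 : ℝ) ^ n * y⌋₊| ≤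
        C * ((n : ℝ) + 1) ^ k * triadicWeight a n ⌊(3 : ℝ) ^ n * y⌋₊ := by
  have hc : 1 - 2 * a ≠ 0 := fun h => h2 (by linarith)
  set D := (1 / |a| + 2 / |1 - 2 * a|) ^ k * (1 + 2 ^ k) with hD
  have hD0 : 0 ≤ D := by positivity
  have hs : Summable fun i : ℕ => ((i : ℝ) + 1) ^ k * a ^ i := by
    have h := (summable_nat_add_iff 1).2 (summable_pow_mul_geometric_of_norm_lt_one k
      (r := a) (by rwa [Real.norm_of_nonneg h0.le]))
    refine (h.mul_left a⁻¹).congr fun n => ?_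
    rw [pow_succ a n]
    push_cast
    field_simp
  set S := ∑' i : ℕ, ((i : ℝ) + 1) ^ k * a ^ i
  have hS : 0 ≤ S := tsum_nonneg fun i => by positivity
  refine ⟨D * S, by positivity, fun y hy0 hy1 n => ?_⟩
  have hw : ∀ i, a ^ (i + n - lCount y (i + n)) * |1 - 2 * a| ^ lCount y (i + n) ≤
      a ^ i * (a ^ (n - lCount y n) * |1 - 2 * a| ^ lCount y n) := by
    intro i
    induction i with
    | zero => simp
    | succ i ih =>
      have hle := lCount_le y (i + n)
      rw [show i + 1 + n = i + n + 1 by ring, lCount_succ, pow_succ' a i, mul_assoc a]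
      refine le_trans ?_ (mul_le_mul_of_nonneg_left ih h0.le)
      split_ifs
      · rw [show i + n + 1 - (lCount y (i + n) + 1) = i + n - lCount y (i + n) by omega, pow_succ,
          ← mul_assoc, mul_comm a]
        gcongr
      · rw [add_zero, show i + n + 1 - lCount y (i + n) = i + n - lCount y (i + n) + 1 by omega,
          pow_succ]
        exact le_of_eq (by ring)
  obtain ⟨hsum, heq⟩ := mfun_eq_tsum k h0 h1 h2 y
  rw [← sum_termDeriv_eq k a hy0 hy1, heq, ← hsum.sum_add_tsum_nat_add n, add_sub_cancel_left,
    triadicWeight, ← lCount_eq hy0 hy1]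
  set w := a ^ (n - lCount y n) * |1 - 2 * a| ^ lCount y n with hwdef
  have hw0 : 0 ≤ w := by positivity
  have hg : HasSum (fun i : ℕ => D * ((n : ℝ) + 1) ^ k * w * (((i : ℝ) + 1) ^ k * a ^ i))
      (D * ((n : ℝ) + 1) ^ k * w * S) := hs.hasSum.mul_left _
  have h := tsum_of_norm_bounded (f := fun i => termDeriv k y (i + n) a) hg fun i => by
    refine (abs_termDeriv_le k y (i + n) h0.ne' hc (by rw [abs_of_pos h0]; exact h1.le)).trans ?_
    rw [← hD, abs_of_pos h0]
    have e : (((i + n : ℕ) : ℝ) + 1) ^ k ≤ ((n : ℝ) + 1) ^ k * ((i : ℝ) + 1) ^ k := by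
      rw [← mul_pow]
      gcongr
      push_cast
      nlinarith [mul_nonneg (n.cast_nonneg (α := ℝ)) (i.cast_nonneg (α := ℝ))]
    calc _ ≤ D * (((n : ℝ) + 1) ^ k * ((i : ℝ) + 1) ^ k) * (a ^ i * w) := by
          exact mul_le_mul (mul_le_mul_of_nonneg_left e hD0) (hw i) (by positivity)
            (by positivity)
      _ = _ := by ring
  rw [← Real.norm_eq_abs]
  exact h.trans_eq (by ring)

/-- Oscillation of `Mfun k a` over adjacent triadic intervals. -/
lemma exists_abs_mfun_sub_le (k : ℕ) {a : ℝ} (h0 : 0 < a) (h1 : a < 1)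
    (h2 : a ≠ 1 / 2) (hca : |1 - 2 * a| ≤ a) :
    ∃ C : ℝ, 0 ≤ C ∧ ∀ x y : ℝ, 0 ≤ x → x < 1 → 0 ≤ y → y < 1 → ∀ n : ℕ, |y - x| ≤ (1 / 3) ^ n →
      |Mfun k a y - Mfun k a x| ≤
        C * ((n : ℝ) + 1) ^ k * triadicWeight a n ⌊(3 : ℝ) ^ n * x⌋₊ := by
  obtain ⟨T, hT, htail⟩ := exists_abs_mfun_sub_partialDeriv_le k h0 h1 h2 hca
  have hc : 1 - 2 * a ≠ 0 := fun h => h2 (by linarith)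
  have hc' : 0 < |1 - 2 * a| := abs_pos.2 hc
  set R := a / |1 - 2 * a| with hR
  have hR1 : 1 ≤ R := (one_le_div hc').2 hca
  set K := (1 / |a| + 2 / |1 - 2 * a|) ^ k with hK
  have hK0 : 0 ≤ K := by positivity
  refine ⟨T + T * R + K * R, by positivity, fun x y hx0 hx1 hy0 hy1 n hxy => ?_⟩
  have hX := htail x hx0 hx1 n
  have hY := htail y hy0 hy1 n
  have h3 : (0 : ℝ) < 3 ^ n := by positivity
  have hlt : ∀ z : ℝ, 0 ≤ z → z < 1 → ⌊(3 : ℝ) ^ n * z⌋₊ < 3 ^ n := fun z hz hz1 => by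
    rw [Nat.floor_lt (by positivity)]
    push_cast
    nlinarith
  have hp := hlt x hx0 hx1
  have hq := hlt y hy0 hy1
  have hpf := Nat.floor_le (a := (3 : ℝ) ^ n * x) (by positivity)
  have hpl := Nat.lt_floor_add_one ((3 : ℝ) ^ n * x)
  have hqf := Nat.floor_le (a := (3 : ℝ) ^ n * y) (by positivity)
  have hql := Nat.lt_floor_add_one ((3 : ℝ) ^ n * y)
  set p := ⌊(3 : ℝ) ^ n * x⌋₊
  set q := ⌊(3 : ℝ) ^ n * y⌋₊
  have hd : |(3 : ℝ) ^ n * y - 3 ^ n * x| ≤ 1 := by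
    rw [← mul_sub, abs_mul, abs_of_pos h3]
    calc _ ≤ (3 : ℝ) ^ n * (1 / 3) ^ n := by gcongr
      _ = 1 := by rw [← mul_pow]; norm_num
  obtain ⟨hd1, hd2⟩ := abs_le.1 hd
  have hqp : q < p + 2 := by
    have : (q : ℝ) < p + 2 := by linarith
    exact_mod_cast this
  have hpq : p < q + 2 := by
    have : (p : ℝ) < q + 2 := by linarith
    exact_mod_cast this
  have hw0 : ∀ N, 0 ≤ triadicWeight a n N := fun N => by unfold triadicWeight; positivity
  -- the increment between the left endpoints, and comparison of weights
  have hinc : ∀ N, N + 1 < 3 ^ n → |partialDeriv k a n (N + 1) - partialDeriv k a n N| ≤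
      K * ((n : ℝ) + 1) ^ k * triadicWeight a n N := fun N hN => by
    rw [partialDeriv_succ_sub k a n N hN]
    refine (abs_wDeriv_le k _ _ h0.ne' hc).trans_eq ?_
    rw [Nat.cast_sub (ternaryOnes_le n N), sub_add_cancel, triadicWeight]
    congr 3
    exact abs_of_pos h0
  have hcmp : ∀ N, triadicWeight a n (N + 1) ≤ R * triadicWeight a n N ∧
      triadicWeight a n N ≤ R * triadicWeight a n (N + 1) := fun N =>
    have h := ternaryOnes_succ_le n N
    ⟨pow_mul_pow_le_of_close hc' hca (ternaryOnes_le _ _) (ternaryOnes_le _ _) h.1 h.2,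
      pow_mul_pow_le_of_close hc' hca (ternaryOnes_le _ _) (ternaryOnes_le _ _) h.2 h.1⟩
  have hwle : triadicWeight a n p ≤ R * triadicWeight a n p := le_mul_of_one_le_left (hw0 p) hR1
  have hboth : triadicWeight a n q ≤ R * triadicWeight a n p ∧
      |partialDeriv k a n q - partialDeriv k a n p| ≤
        K * ((n : ℝ) + 1) ^ k * (R * triadicWeight a n p) := by
    rcases (by omega : q = p ∨ q = p + 1 ∨ p = q + 1) with h | h | h
    · rw [h, sub_self, abs_zero]
      exact ⟨hwle, mul_nonneg (by positivity) ((hw0 p).trans hwle)⟩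
    · rw [h] at hq ⊢
      refine ⟨(hcmp p).1, (hinc p hq).trans ?_⟩
      gcongr
    · rw [h] at hp ⊢
      refine ⟨(hcmp q).2, ?_⟩
      rw [abs_sub_comm]
      refine (hinc q hp).trans ?_
      gcongr
      exact (hcmp q).2
  have hY' : |Mfun k a y - partialDeriv k a n q| ≤
      T * ((n : ℝ) + 1) ^ k * (R * triadicWeight a n p) := hY.trans (by gcongr; exact hboth.1)
  calc |Mfun k a y - Mfun k a x| = |(Mfun k a y - partialDeriv k a n q) +
        ((partialDeriv k a n q - partialDeriv k a n p) -
          (Mfun k a x - partialDeriv k a n p))| := by congr 1; ring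
    _ ≤ _ := (abs_add_le _ _).trans (add_le_add hY' ((abs_sub _ _).trans (add_le_add hboth.2 hX)))
    _ = _ := by ring

lemma hasDerivAt_mfun_zero (k : ℕ) {a : ℝ} (h0 : 0 < a) (h1 : a < 1) (h2 : a ≠ 1 / 2)
    (hca : |1 - 2 * a| ≤ a) {x : ℝ} (hx : x ∈ Set.Ioo (0 : ℝ) 1)
    (h : Tendsto (fun n : ℕ => ((n : ℝ) + 1) ^ k *
      (3 ^ n * triadicWeight a n ⌊(3 : ℝ) ^ n * x⌋₊)) atTop (𝓝 0)) :
    HasDerivAt (Mfun k a) 0 x := by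
  obtain ⟨C, hC, hosc⟩ := exists_abs_mfun_sub_le k h0 h1 h2 hca
  rw [hasDerivAt_iff_isLittleO, Asymptotics.isLittleO_iff]
  intro ε hε
  obtain ⟨n₀, hn₀⟩ := eventually_atTop.1
    ((h.const_mul (3 * C)).eventually_le_const (u := ε) (by simpa using hε))
  have hball : ∀ᶠ y in 𝓝 x, |y - x| < (1 / 3) ^ n₀ := by
    have := Metric.ball_mem_nhds x (show (0 : ℝ) < (1 / 3) ^ n₀ by positivity)
    filter_upwards [this] with y hy
    rwa [Metric.mem_ball, Real.dist_eq] at hy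
  filter_upwards [hball, isOpen_Ioo.mem_nhds hx] with y hy hy01
  rw [smul_zero, sub_zero, Real.norm_eq_abs, Real.norm_eq_abs]
  rcases eq_or_ne y x with rfl | hne
  · simp
  have hpos : 0 < |y - x| := abs_pos.2 (sub_ne_zero.2 hne)
  obtain ⟨n, hn1, hn2⟩ := exists_nat_pow_near_of_lt_one hpos
    (hy.le.trans (pow_le_one₀ (by norm_num) (by norm_num))) (show (0 : ℝ) < 1 / 3 by norm_num)
    (by norm_num)
  have hn : n₀ ≤ n := by
    have := (pow_lt_pow_iff_right_of_lt_one₀ (show (0 : ℝ) < 1 / 3 by norm_num)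
      (by norm_num)).1 (hn1.trans hy)
    omega
  have hb := hn₀ n hn
  refine (hosc x y hx.1.le hx.2 hy01.1.le hy01.2 n hn2).trans ?_
  have h3 : (3 : ℝ) ^ n * (1 / 3) ^ n = 1 := by rw [← mul_pow]; norm_num
  calc C * ((n : ℝ) + 1) ^ k * triadicWeight a n ⌊(3 : ℝ) ^ n * x⌋₊
      = 3 * C * (((n : ℝ) + 1) ^ k * (3 ^ n * triadicWeight a n ⌊(3 : ℝ) ^ n * x⌋₊)) *
        (1 / 3) ^ (n + 1) := by
        rw [pow_succ]
        linear_combination -(C * ((n : ℝ) + 1) ^ k * triadicWeight a n ⌊(3 : ℝ) ^ n * x⌋₊) * h3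
    _ ≤ ε * |y - x| := by gcongr

lemma ternaryOnes_mul_pow (n i N : ℕ) : ternaryOnes (n + i) (N * 3 ^ i) = ternaryOnes n N := by
  induction i with
  | zero => simp
  | succ i ih =>
    rw [← add_assoc, ternaryOnes, show N * 3 ^ (i + 1) / 3 = N * 3 ^ i by
      rw [pow_succ, ← mul_assoc]; omega, ih, show N * 3 ^ (i + 1) % 3 = 0 by rw [pow_succ, ← mul_assoc]; omega]
    simp

/-- If `Mfun k a` has a derivative at `x`, its slopes over the leftmost triadic subintervals of
the triadic intervals containing `x` converge to it. -/
lemma tendsto_slope_triadic (k : ℕ) {a : ℝ} (h0 : 0 < a) (h1 : a < 1) (h2 : a ≠ 1 / 2)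
    {x d : ℝ} (hx : x ∈ Set.Ioo (0 : ℝ) 1) (hd : HasDerivAt (Mfun k a) d x) (i : ℕ) :
    Tendsto (fun n : ℕ => (3 : ℝ) ^ n * wDeriv k (n - lCount x n + i) (lCount x n) a)
      atTop (𝓝 (d / 3 ^ i)) := by
  set u : ℕ → ℝ := fun n => (⌊(3 : ℝ) ^ n * x⌋₊ : ℝ) / 3 ^ n with hu
  set v : ℕ → ℝ := fun n => u n + (1 / 3) ^ n * (1 / 3) ^ i with hv
  have h3 : Tendsto (fun n : ℕ => (1 / 3 : ℝ) ^ n) atTop (𝓝 0) :=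
    tendsto_pow_atTop_nhds_zero_of_lt_one (by norm_num) (by norm_num)
  have hux : ∀ n, |u n - x| ≤ (1 / 3) ^ n := fun n => by
    have hp : (0 : ℝ) < 3 ^ n := by positivity
    have hpf := Nat.floor_le (a := (3 : ℝ) ^ n * x) (mul_nonneg hp.le hx.1.le)
    have hpl := Nat.lt_floor_add_one ((3 : ℝ) ^ n * x)
    have hun : u n * 3 ^ n = ⌊(3 : ℝ) ^ n * x⌋₊ := div_mul_cancel₀ _ hp.ne'
    have he : u n - x = ((⌊(3 : ℝ) ^ n * x⌋₊ : ℝ) - 3 ^ n * x) / 3 ^ n := by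
      rw [hu]; field_simp
    rw [he, abs_div, abs_of_pos hp, one_div_pow]
    gcongr
    rw [abs_le]
    constructor <;> linarith
  have hvx : ∀ n, |v n - x| ≤ 2 * (1 / 3) ^ n := fun n => by
    have : v n - x = (u n - x) + (1 / 3) ^ n * (1 / 3) ^ i := by rw [hv]; ring
    rw [this]
    refine (abs_add_le _ _).trans ?_
    have h5 : |(1 / 3 : ℝ) ^ n * (1 / 3) ^ i| ≤ (1 / 3) ^ n := by
      rw [abs_of_nonneg (by positivity)]
      exact mul_le_of_le_one_right (by positivity) (pow_le_one₀ (by norm_num) (by norm_num))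
    linarith [hux n]
  have hO : ∀ w : ℕ → ℝ, (∀ n, |w n - x| ≤ 2 * (1 / 3) ^ n) →
      (fun n => Mfun k a (w n) - Mfun k a x - (w n - x) * d) =o[atTop]
        (fun n : ℕ => (1 / 3 : ℝ) ^ n) := by
    intro w hw
    have hlim : Tendsto w atTop (𝓝 x) := by
      rw [tendsto_iff_norm_sub_tendsto_zero]
      exact squeeze_zero (fun n => norm_nonneg _) hw (by simpa using h3.const_mul 2)
    have := (hasDerivAt_iff_isLittleO.1 hd).comp_tendsto hlim
    refine this.trans_isBigO (Asymptotics.IsBigO.of_bound 2 (Eventually.of_forall fun n => ?_))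
    rw [Real.norm_eq_abs, Real.norm_eq_abs, abs_of_nonneg (show (0 : ℝ) ≤ (1 / 3) ^ n by positivity)]
    exact hw n
  have ho := (hO v hvx).sub (hO u fun n => (hux n).trans
    (le_mul_of_one_le_left (by positivity) one_le_two))
  have ht := ho.tendsto_div_nhds_zero.add_const (d / 3 ^ i)
  rw [zero_add] at ht
  refine ht.congr' ?_
  have hlarge : ∀ᶠ n : ℕ in atTop, (1 / 3 : ℝ) ^ n < 1 - x :=
    h3.eventually_lt_const (sub_pos.2 hx.2)
  filter_upwards [hlarge] with n hn
  have hp : (0 : ℝ) < 3 ^ n := by positivity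
  set p := ⌊(3 : ℝ) ^ n * x⌋₊ with hpdef
  have hpf : (p : ℝ) ≤ (3 : ℝ) ^ n * x := Nat.floor_le (mul_nonneg hp.le hx.1.le)
  have hN : p + 1 < 3 ^ n := by
    rw [one_div_pow, div_lt_iff₀ hp] at hn
    have : (p : ℝ) + 1 < 3 ^ n := by nlinarith
    exact_mod_cast this
  have hN' : p * 3 ^ i + 1 < 3 ^ (n + i) := by
    have h3i : 1 ≤ 3 ^ i := Nat.one_le_pow _ _ (by norm_num)
    calc p * 3 ^ i + 1 ≤ (p + 1) * 3 ^ i := by rw [add_mul]; omega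
      _ < 3 ^ n * 3 ^ i := by gcongr
      _ = _ := (pow_add 3 n i).symm
  have hun : u n = ((p * 3 ^ i : ℕ) : ℝ) / 3 ^ (n + i) := by
    rw [hu, pow_add]; push_cast; field_simp; rw [← hpdef]
  have hvn : v n = ((p * 3 ^ i + 1 : ℕ) : ℝ) / 3 ^ (n + i) := by
    simp only [hv]
    rw [hun, pow_add, one_div_pow, one_div_pow]; push_cast; field_simp
  have hle := ternaryOnes_le n p
  have hM : Mfun k a (v n) - Mfun k a (u n) =
      wDeriv k (n - lCount x n + i) (lCount x n) a := by
    rw [hvn, hun, mfun_triadic k h0 h1 h2 _ _ hN', mfun_triadic k h0 h1 h2 _ _ (by omega),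
      partialDeriv_succ_sub k a _ _ hN', ternaryOnes_mul_pow, lCount_eq hx.1.le hx.2,
      show n + i - ternaryOnes n p = n - ternaryOnes n p + i by omega]
  have hvu : v n - u n = (1 / 3) ^ n * (1 / 3) ^ i := by simp only [hv]; ring
  rw [← hM, show Mfun k a (v n) - Mfun k a x - (v n - x) * d - (Mfun k a (u n) - Mfun k a x -
    (u n - x) * d) = Mfun k a (v n) - Mfun k a (u n) - (v n - u n) * d by ring, hvu,
    one_div_pow, one_div_pow]
  field_simp
  ring

lemma tendsto_wDeriv_descend (k : ℕ) {a : ℝ} (ha : a ≠ 1 / 3) (m l : ℕ → ℕ) (d : ℝ)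
    (h : ∀ i : ℕ, Tendsto (fun n : ℕ => (3 : ℝ) ^ n * wDeriv k (m n + i) (l n) a) atTop
      (𝓝 (d / 3 ^ i))) :
    ∃ κ : ℝ, κ ≠ 0 ∧
      Tendsto (fun n : ℕ => (3 : ℝ) ^ n * wDeriv 0 (m n) (l n) a) atTop (𝓝 (d * κ)) := by
  induction k generalizing d with
  | zero => exact ⟨1, one_ne_zero, by simpa using h 0⟩
  | succ k ih =>
    have hk : (k : ℝ) + 1 ≠ 0 := by positivity
    have ha' : 1 / 3 - a ≠ 0 := sub_ne_zero.2 ha.symm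
    obtain ⟨κ, hκ, ht⟩ := ih (d * ((1 / 3 - a) / (k + 1))) fun i => by
      have h1 := ((h (i + 1)).sub ((h i).const_mul a)).div_const ((k : ℝ) + 1)
      have e : (d / 3 ^ (i + 1) - a * (d / 3 ^ i)) / ((k : ℝ) + 1) =
          d * ((1 / 3 - a) / (k + 1)) / 3 ^ i := by
        rw [pow_succ]; field_simp
      rw [e] at h1
      refine h1.congr fun n => ?_
      rw [← add_assoc, wDeriv_succ_left]
      field_simp
      ring
    exact ⟨(1 / 3 - a) / (k + 1) * κ, mul_ne_zero (div_ne_zero ha' hk) hκ, by rwa [← mul_assoc]⟩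

lemma one_sub_two_mul_lt_phi {a : ℝ} (ha : 1 / 3 < a) (ha2 : a < 1 / 2) :
    (1 - 2 * a) * (Real.log a - Real.log (1 - 2 * a)) < Real.log (3 * a) := by
  have h0 : 0 < a := by linarith
  have hc : 0 < 1 - 2 * a := by linarith
  have e1 := Real.log_le_sub_one_of_pos (inv_pos.2 (show 0 < 3 * a by linarith))
  have e2 := Real.log_lt_sub_one_of_pos (inv_pos.2 (show 0 < 3 * (1 - 2 * a) by linarith))
    (by rw [ne_eq, inv_eq_one]; intro h; linarith)
  rw [Real.log_inv, Real.log_mul (by norm_num) h0.ne'] at e1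
  rw [Real.log_inv, Real.log_mul (by norm_num) hc.ne'] at e2
  rw [Real.log_mul (by norm_num) h0.ne']
  have f1 := mul_le_mul_of_nonneg_left e1 (show 0 ≤ 2 * a by linarith)
  have f2 := mul_lt_mul_of_pos_left e2 hc
  have g1 : 2 * a * ((3 * a)⁻¹ - 1) = 2 / 3 - 2 * a := by field_simp
  have g2 : (1 - 2 * a) * ((3 * (1 - 2 * a))⁻¹ - 1) = 1 / 3 - (1 - 2 * a) := by field_simp
  nlinarith

lemma abs_wDeriv_zero {a : ℝ} (h0 : 0 < a) (m l : ℕ) :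
    |wDeriv 0 m l a| = a ^ m * |1 - 2 * a| ^ l := by
  rw [wDeriv, abs_mul, abs_pow, abs_pow, abs_of_pos h0]

/-- If the slopes of Okamoto's function over triadic intervals stay bounded, the logarithmic
derivative of the increments grows linearly. -/
lemma exists_le_abs_logDeriv {a : ℝ} (ha : 1 / 3 < a) (ha' : a < 2 / 3) (ha'' : a ≠ 1 / 2)
    (l : ℕ → ℕ) (hl : ∀ n, l n ≤ n) {B : ℝ}
    (hB : ∀ᶠ n : ℕ in atTop, (3 : ℝ) ^ n * |wDeriv 0 (n - l n) (l n) a| ≤ B) :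
    ∃ δ : ℝ, 0 < δ ∧ ∀ᶠ n : ℕ in atTop,
      δ * ((n : ℝ) + 1) ≤ |((n - l n : ℕ) : ℝ) / a - 2 * l n / (1 - 2 * a)| := by
  have h0 : 0 < a := by linarith
  rcases lt_or_gt_of_ne ha'' with h | h
  · have hc : 0 < 1 - 2 * a := by linarith
    set c := 1 - 2 * a with hcdef
    set μ := Real.log a - Real.log c with hμ
    have hμ0 : 0 < μ := sub_pos.2 (Real.log_lt_log hc (by linarith))
    set φ := Real.log (3 * a) / μ with hφ
    have hcφ : c < φ := (lt_div_iff₀ hμ0).2 (one_sub_two_mul_lt_phi ha h)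
    refine ⟨(φ - c) / (2 * (a * c)), by have := sub_pos.2 hcφ; positivity, ?_⟩
    have hlarge : ∀ᶠ n : ℕ in atTop,
        2 / (φ - c) * (Real.log B / μ + (φ - c) / 2) ≤ (n : ℝ) :=
      tendsto_natCast_atTop_atTop.eventually_ge_atTop _
    filter_upwards [hB, hlarge] with n hn hn2
    have hW : 0 < (3 : ℝ) ^ n * (a ^ (n - l n) * c ^ l n) := by positivity
    rw [abs_wDeriv_zero h0, ← hcdef, abs_of_pos hc] at hn
    have hlog := Real.log_le_log hW hn
    rw [Real.log_mul (by positivity) (by positivity), Real.log_mul (by positivity) (by positivity),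
      Real.log_pow, Real.log_pow, Real.log_pow, Nat.cast_sub (hl n)] at hlog
    have h3a : Real.log (3 * a) = Real.log 3 + Real.log a := Real.log_mul (by norm_num) h0.ne'
    have hφμ : φ * μ = Real.log (3 * a) := div_mul_cancel₀ _ hμ0.ne'
    have hln : n * φ - Real.log B / μ ≤ l n := by
      have : (n * φ - l n) * μ ≤ Real.log B := by
        rw [sub_mul, mul_assoc, hφμ, h3a, hμ]
        linarith
      rw [← le_div_iff₀ hμ0] at this
      linarith
    have hn3 : Real.log B / μ + (φ - c) / 2 ≤ (φ - c) / 2 * n := by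
      have h' := mul_le_mul_of_nonneg_left hn2 (show 0 ≤ (φ - c) / 2 by linarith)
      have hne : φ - c ≠ 0 := (sub_pos.2 hcφ).ne'
      refine le_trans (le_of_eq ?_) h'
      field_simp
    have e : ((n - l n : ℕ) : ℝ) / a - 2 * l n / c = -((l n - n * c) / (a * c)) := by
      rw [Nat.cast_sub (hl n)]
      field_simp
      rw [hcdef]
      ring
    rw [e, abs_neg]
    refine le_trans ?_ (le_abs_self _)
    rw [div_mul_eq_mul_div, div_le_div_iff₀ (by positivity) (by positivity)]
    have : (φ - c) * ((n : ℝ) + 1) ≤ 2 * (l n - n * c) := by linarith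
    nlinarith [mul_pos h0 hc]
  · have hc : 1 - 2 * a < 0 := by linarith
    refine ⟨1 / 2, by norm_num, ?_⟩
    filter_upwards [eventually_ge_atTop 1] with n hn
    have hn' : (1 : ℝ) ≤ n := by exact_mod_cast hn
    have h1 : ((n - l n : ℕ) : ℝ) ≤ ((n - l n : ℕ) : ℝ) / a :=
      le_div_self (Nat.cast_nonneg _) h0 (by linarith)
    have h2 : (l n : ℝ) ≤ -(2 * l n / (1 - 2 * a)) := by
      rw [← div_neg, le_div_iff₀ (by linarith)]
      have : (0 : ℝ) ≤ l n := Nat.cast_nonneg _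
      nlinarith
    rw [Nat.cast_sub (hl n)] at h1 ⊢
    refine le_trans ?_ (le_abs_self _)
    linarith

lemma eventually_le_abs_wDeriv (j : ℕ) {a δ : ℝ} (h0 : a ≠ 0) (hc : 1 - 2 * a ≠ 0) (hδ : 0 < δ)
    (l : ℕ → ℕ) (hl : ∀ n, l n ≤ n)
    (h : ∀ᶠ n : ℕ in atTop,
      δ * ((n : ℝ) + 1) ≤ |((n - l n : ℕ) : ℝ) / a - 2 * l n / (1 - 2 * a)|) :
    ∀ᶠ n : ℕ in atTop, δ ^ (j + 1) / 2 * (((n : ℝ) + 1) ^ (j + 1) * |wDeriv 0 (n - l n) (l n) a|) ≤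
      |wDeriv (j + 1) (n - l n) (l n) a| := by
  obtain ⟨C, hC, hasym⟩ := exists_abs_wDeriv_sub_le j h0 hc
  have hlarge : ∀ᶠ n : ℕ in atTop, 2 * C / δ ^ (j + 1) ≤ (n : ℝ) :=
    tendsto_natCast_atTop_atTop.eventually_ge_atTop _
  filter_upwards [h, hlarge] with n hn hn2
  have h1 := hasym (n - l n) (l n)
  have hcast : ((n - l n : ℕ) : ℝ) + l n + 1 = n + 1 := by
    rw [Nat.cast_sub (hl n), sub_add_cancel]
  rw [hcast] at h1
  set G := wDeriv 0 (n - l n) (l n) a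
  set H := ((n - l n : ℕ) : ℝ) / a - 2 * l n / (1 - 2 * a)
  have h2 : |G * H ^ (j + 1)| - |wDeriv (j + 1) (n - l n) (l n) a| ≤
      C * ((n : ℝ) + 1) ^ j * |G| := by
    refine (abs_sub_abs_le_abs_sub _ _).trans ?_
    rwa [abs_sub_comm]
  have h3 : |G| * (δ * ((n : ℝ) + 1)) ^ (j + 1) ≤ |G * H ^ (j + 1)| := by
    rw [abs_mul, abs_pow]
    gcongr
  have h4 : C ≤ δ ^ (j + 1) / 2 * ((n : ℝ) + 1) := by
    rw [div_le_iff₀ (by positivity)] at hn2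
    have : 0 < δ ^ (j + 1) := by positivity
    linarith
  have h5 : C * ((n : ℝ) + 1) ^ j * |G| ≤
      δ ^ (j + 1) / 2 * ((n : ℝ) + 1) * ((n : ℝ) + 1) ^ j * |G| := by gcongr
  rw [mul_pow] at h3
  rw [pow_succ ((n : ℝ) + 1)] at h3 ⊢
  linarith

/-- A finite derivative of `Mfun k a` must vanish, and forces decay of the triadic increments. -/
lemma eq_zero_and_tendsto_of_hasDerivAt {k : ℕ} (hk : 1 ≤ k) {a : ℝ} (ha : 1 / 3 < a)
    (ha' : a < 2 / 3) (ha'' : a ≠ 1 / 2) {x d : ℝ} (hx : x ∈ Set.Ioo (0 : ℝ) 1)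
    (hd : HasDerivAt (Mfun k a) d x) :
    d = 0 ∧ Tendsto (fun n : ℕ => ((n : ℝ) + 1) ^ k *
      (3 ^ n * |wDeriv 0 (n - lCount x n) (lCount x n) a|)) atTop (𝓝 0) := by
  have h0 : 0 < a := by linarith
  have hc : 1 - 2 * a ≠ 0 := fun h => ha'' (by linarith)
  have hslope := tendsto_slope_triadic k h0 (by linarith) ha'' hx hd
  obtain ⟨κ, hκ, hlim⟩ := tendsto_wDeriv_descend k ha.ne' (fun n => n - lCount x n)
    (fun n => lCount x n) d hslope
  have habs : ∀ j n : ℕ, |(3 : ℝ) ^ n * wDeriv j (n - lCount x n) (lCount x n) a| =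
      3 ^ n * |wDeriv j (n - lCount x n) (lCount x n) a| := fun j n => by
    rw [abs_mul, abs_of_pos (by positivity : (0 : ℝ) < 3 ^ n)]
  have hlim' := hlim.abs
  have hslope' := (hslope 0).abs
  simp only [add_zero, pow_zero, div_one, habs] at hlim' hslope'
  obtain ⟨δ, hδ, hlin⟩ := exists_le_abs_logDeriv ha ha' ha'' (fun n => lCount x n) (lCount_le x)
    (hlim'.eventually_le_const (lt_add_one _))
  obtain ⟨j, rfl⟩ := Nat.exists_eq_add_of_le' hk
  have hlow := eventually_le_abs_wDeriv j h0.ne' hc hδ (fun n => lCount x n) (lCount_le x) hlin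
  have hlow' : ∀ᶠ n : ℕ in atTop, ((n : ℝ) + 1) ^ (j + 1) *
      (3 ^ n * |wDeriv 0 (n - lCount x n) (lCount x n) a|) ≤
      2 / δ ^ (j + 1) * (3 ^ n * |wDeriv (j + 1) (n - lCount x n) (lCount x n) a|) := by
    filter_upwards [hlow] with n hn
    have h := mul_le_mul_of_nonneg_left hn (show 0 ≤ 2 / δ ^ (j + 1) * 3 ^ n by positivity)
    refine le_trans (le_of_eq ?_) (h.trans_eq (by ring))
    field_simp
  have hup := hslope'.const_mul (2 / δ ^ (j + 1))
  have hinv : Tendsto (fun n : ℕ => 1 / ((n : ℝ) + 1)) atTop (𝓝 0) :=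
    tendsto_one_div_add_atTop_nhds_zero_nat
  have hz : Tendsto (fun n : ℕ => 3 ^ n * |wDeriv 0 (n - lCount x n) (lCount x n) a|)
      atTop (𝓝 0) := by
    refine squeeze_zero' (Eventually.of_forall fun n => by positivity) ?_
      (by rw [← zero_mul]; exact hinv.mul hup)
    filter_upwards [hlow'] with n hn
    rw [div_mul_eq_mul_div, one_mul, le_div_iff₀ (by positivity), mul_comm]
    refine le_trans ?_ hn
    gcongr
    exact le_self_pow₀ (by linarith [n.cast_nonneg (α := ℝ)]) (Nat.succ_ne_zero j)
  have hd0 : d = 0 := by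
    have := tendsto_nhds_unique hlim' hz
    simpa [hκ] using this
  refine ⟨hd0, squeeze_zero' (Eventually.of_forall fun n => by positivity) hlow' ?_⟩
  simpa [hd0] using hup

lemma tendsto_atTop_iff_tendsto_triadic (k : ℕ) {a : ℝ} (ha : 1 / 3 < a) (ha' : a < 2 / 3)
    (ha'' : a ≠ 1 / 2) (l : ℕ → ℕ) (hl : ∀ n, l n ≤ n) :
    Tendsto (fun n : ℕ => ((l n : ℝ) - (n : ℝ) * phiOk a) - (k : ℝ) * C0 a * Real.log n)
        atTop atTop ↔
      Tendsto (fun n : ℕ => ((n : ℝ) + 1) ^ k * (3 ^ n * |wDeriv 0 (n - l n) (l n) a|))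
        atTop (𝓝 0) := by
  have h0 : 0 < a := by linarith
  have hc : 0 < |1 - 2 * a| := abs_pos.2 fun h => ha'' (by linarith)
  have hca : |1 - 2 * a| < a := by rw [abs_lt]; constructor <;> linarith
  set μ := Real.log a - Real.log |1 - 2 * a| with hμ
  have hμ0 : 0 < μ := sub_pos.2 (Real.log_lt_log hc hca)
  have hφ : phiOk a = Real.log (3 * a) / μ := by
    rw [phiOk, if_neg ha.ne', if_neg ha'']
  have hexp : ∀ n : ℕ, 1 ≤ n → Real.exp (-μ * (((l n : ℝ) - (n : ℝ) * phiOk a) -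
      (k : ℝ) * C0 a * Real.log n)) = (n : ℝ) ^ k * (3 ^ n * |wDeriv 0 (n - l n) (l n) a|) := by
    intro n hn
    have hn0 : (0 : ℝ) < n := by exact_mod_cast hn
    rw [abs_wDeriv_zero h0, ← Real.exp_log (show 0 < (n : ℝ) ^ k *
      (3 ^ n * (a ^ (n - l n) * |1 - 2 * a| ^ l n)) by positivity)]
    congr 1
    rw [Real.log_mul (by positivity) (by positivity), Real.log_mul (by positivity) (by positivity),
      Real.log_mul (by positivity) (by positivity), Real.log_pow, Real.log_pow, Real.log_pow,
      Real.log_pow, Nat.cast_sub (hl n), hφ, C0, ← hμ]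
    have h3a : Real.log (3 * a) = Real.log 3 + Real.log a := Real.log_mul (by norm_num) h0.ne'
    have : -μ * ((l n : ℝ) - n * (Real.log (3 * a) / μ) - k * (1 / μ) * Real.log n) =
        -μ * l n + n * Real.log (3 * a) + k * Real.log n := by field_simp; ring
    rw [this, h3a, hμ]
    ring
  have hiff : Tendsto (fun n : ℕ => ((l n : ℝ) - (n : ℝ) * phiOk a) - (k : ℝ) * C0 a * Real.log n)
        atTop atTop ↔ Tendsto (fun n : ℕ => (n : ℝ) ^ k *
          (3 ^ n * |wDeriv 0 (n - l n) (l n) a|)) atTop (𝓝 0) := by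
    rw [← tendsto_const_mul_atBot_of_neg (neg_neg_of_pos hμ0), ← Real.tendsto_exp_comp_nhds_zero]
    refine tendsto_congr' ?_
    filter_upwards [eventually_ge_atTop 1] with n hn using hexp n hn
  rw [hiff]
  constructor
  · intro h
    refine squeeze_zero' (Eventually.of_forall fun n => by positivity) ?_
      (by simpa using h.const_mul (2 ^ k))
    filter_upwards [eventually_ge_atTop 1] with n hn
    have hn' : (1 : ℝ) ≤ n := by exact_mod_cast hn
    rw [← mul_assoc (2 ^ k), ← mul_pow]
    gcongr
    linarith
  · intro h
    refine squeeze_zero (fun n => by positivity) (fun n => ?_) h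
    gcongr
    linarith

/-- for `k ≥ 1` and `1/3 < a < 2/3`, `a ≠ 1/2`, `M_{k,a}` has a finite
derivative at `x ∈ (0,1)` iff `r_n(x) - k C₀(a) log n → +∞`, in which case it is `0`. -/
theorem stmt4 (k : ℕ) (hk : 1 ≤ k) (a : ℝ) (ha : 1/3 < a) (ha' : a < 2/3) (ha'' : a ≠ 1/2)
    (x : ℝ) (hx : x ∈ Set.Ioo (0:ℝ) 1) :
    ((∃ d : ℝ, HasDerivAt (Mfun k a) d x) ↔
      Tendsto (fun n : ℕ =>
          ((lCount x n : ℝ) - (n : ℝ) * phiOk a) - (k : ℝ) * C0 a * Real.log n)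
        atTop atTop) ∧
    ∀ d : ℝ, HasDerivAt (Mfun k a) d x → d = 0 := by
  have h0 : 0 < a := by linarith
  have hca : |1 - 2 * a| ≤ a := by rw [abs_le]; constructor <;> linarith
  refine ⟨⟨fun ⟨d, hd⟩ => ?_, fun h => ⟨0, ?_⟩⟩, fun d hd =>
    (eq_zero_and_tendsto_of_hasDerivAt hk ha ha' ha'' hx hd).1⟩
  · exact (tendsto_atTop_iff_tendsto_triadic k ha ha' ha'' _ (lCount_le x)).2
      (eq_zero_and_tendsto_of_hasDerivAt hk ha ha' ha'' hx hd).2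
  · refine hasDerivAt_mfun_zero k h0 (by linarith) ha'' hca hx ?_
    refine ((tendsto_atTop_iff_tendsto_triadic k ha ha' ha'' _ (lCount_le x)).1 h).congr fun n => ?_
    rw [abs_wDeriv_zero h0, triadicWeight, ← lCount_eq hx.1.le hx.2]
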